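/- Let k > 0, R > 0, and let u, v : ℝ² → ℂ be four times continuously differentiable on an open neighborhood of the closed disk {x : |x| ≤ R}, with Δ²v − k⁴v = 0 on that neighborhood. Then the fourth-order Green identity holds: ∫_{B_R} (Δ²u − k⁴u) v dx = ∫_{Γ_R} ( (∂_ν Δu) v − (∂_ν v) Δu + (∂_ν u) Δv − (∂_ν Δv) u ) ds. -/

import Mathlib

open MeasureTheory Real Filter ComplexConjugate

noncomputable section

abbrev E2 := EuclideanSpace ℝ (Fin 2)

/-- The Laplacian on ℝ² as the sum of second directional derivatives. -/
def lap (f : E2 → ℂ) (x : E2) : ℂ :=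
  ∑ i : Fin 2, fderiv ℝ (fun y => fderiv ℝ f y (EuclideanSpace.single i (1:ℝ))) x
    (EuclideanSpace.single i (1:ℝ))

/-- Normal derivative on the circle of radius `R`: `∂_ν f (x) = ∇f(x)·(x/R)`. -/
def dnu (R : ℝ) (f : E2 → ℂ) (x : E2) : ℂ := fderiv ℝ f x (R⁻¹ • x)

/-- Point on the circle of radius `R` with polar angle `θ`. -/
def circPt (R θ : ℝ) : E2 := (WithLp.equiv 2 (Fin 2 → ℝ)).symm ![R * Real.cos θ, R * Real.sin θ]

/-- Arclength integral over the circle `Γ_R`. -/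
def circInt (R : ℝ) (g : E2 → ℂ) : ℂ := ∫ θ in (0:ℝ)..(2*Real.pi), g (circPt R θ) * (R:ℂ)

/-- Sommerfeld radiation condition with wavenumber `k`. -/
def Sommerfeld (k : ℝ) (w : E2 → ℂ) : Prop :=
  ∀ ε > 0, ∃ r₀ : ℝ, ∀ x : E2, r₀ ≤ ‖x‖ →
    ‖(Real.sqrt ‖x‖ : ℂ) * (fderiv ℝ w x (‖x‖⁻¹ • x) - Complex.I * (k:ℂ) * w x)‖ < ε

/-- `u` is a radiating solution of `Δ²u − k⁴u = S`. -/
def RadiatingSolution (k : ℝ) (S u : E2 → ℂ) : Prop :=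
  (∀ x : E2, lap (lap u) x - (k:ℂ)^4 * u x = S x) ∧ Sommerfeld k u ∧ Sommerfeld k (lap u)

/-- `S ∈ H(B_R)`: `L²(B_R)`-limit of smooth solutions of `Δ²v = k⁴v` on `B_R`. -/
def memH (k R : ℝ) (S : E2 → ℂ) : Prop :=
  ∃ v : ℕ → E2 → ℂ,
    (∀ j, ContDiffOn ℝ (⊤ : ℕ∞) (v j) (Metric.ball (0:E2) R)) ∧
    (∀ j, ∀ x ∈ Metric.ball (0:E2) R, lap (lap (v j)) x = (k:ℂ)^4 * v j x) ∧
    Tendsto (fun j => ∫ x in Metric.ball (0:E2) R, ‖v j x - S x‖^2) atTop (nhds 0)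

/-- The open square `V₀ = (−a/2, a/2)²`. -/
def V0 (a : ℝ) : Set E2 := {x | x 0 ∈ Set.Ioo (-(a/2)) (a/2) ∧ x 1 ∈ Set.Ioo (-(a/2)) (a/2)}

/-- Fourier basis function `φ_l(x) = exp(i (2π/a) l·x)`. -/
def phi (a : ℝ) (l : ℤ × ℤ) (x : E2) : ℂ :=
  Complex.exp (Complex.I * (2*Real.pi/a) * ((l.1 : ℂ) * ((x 0 : ℝ) : ℂ) + (l.2 : ℂ) * ((x 1 : ℝ) : ℂ)))

/-- `φ_{l₀}(x) = exp(i (2π/a) λ x₁)` for `l₀ = (λ, 0)`. -/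
def phi0 (a lam : ℝ) (x : E2) : ℂ :=
  Complex.exp (Complex.I * (2*Real.pi/a) * (lam : ℂ) * ((x 0 : ℝ) : ℂ))

/-- The `i`-th partial derivative on ℝ². -/
def pd (i : Fin 2) (f : E2 → ℂ) (x : E2) : ℂ := fderiv ℝ f x (EuclideanSpace.single i (1:ℝ))

lemma lap_eq_sum_pd (f : E2 → ℂ) (x : E2) : lap f x = pd 0 (pd 0 f) x + pd 1 (pd 1 f) x := by
  simp only [lap, Fin.sum_univ_two]
  rfl

lemma contDiffOn_pd {m n : WithTop ℕ∞} {U : Set E2} (hU : IsOpen U) {f : E2 → ℂ}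
    (hf : ContDiffOn ℝ n f U) (hmn : m + 1 ≤ n) (i : Fin 2) : ContDiffOn ℝ m (pd i f) U :=
  (hf.fderiv_of_isOpen hU hmn).clm_apply contDiffOn_const

lemma contDiffOn_lap {m n : WithTop ℕ∞} {U : Set E2} (hU : IsOpen U) {f : E2 → ℂ}
    (hf : ContDiffOn ℝ n f U) (hmn : m + 1 + 1 ≤ n) : ContDiffOn ℝ m (lap f) U := by
  have h (i : Fin 2) : ContDiffOn ℝ m (pd i (pd i f)) U :=
    contDiffOn_pd hU (contDiffOn_pd hU hf hmn i) le_rfl i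
  exact ((h 0).add (h 1)).congr fun x _ => lap_eq_sum_pd f x

lemma circPt_eq (r θ : ℝ) : circPt r θ =
    (r * cos θ) • EuclideanSpace.single 0 (1:ℝ) + (r * sin θ) • EuclideanSpace.single 1 (1:ℝ) := by
  ext i
  fin_cases i <;> simp [circPt]

lemma norm_circPt (r θ : ℝ) : ‖circPt r θ‖ = |r| := by
  rw [← Real.sqrt_sq_eq_abs, EuclideanSpace.norm_eq]
  congr 1
  simp only [circPt, WithLp.equiv_symm_apply, Fin.sum_univ_two, Real.norm_eq_abs, sq_abs,
    Matrix.cons_val_zero, Matrix.cons_val_one]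
  linear_combination r ^ 2 * cos_sq_add_sin_sq θ

lemma circPt_mem_closedBall {r R : ℝ} (hr : r ∈ Set.Icc 0 R) (θ : ℝ) :
    circPt r θ ∈ Metric.closedBall (0:E2) R := by
  rw [mem_closedBall_zero_iff, norm_circPt, abs_of_nonneg hr.1]
  exact hr.2

/-- The derivative of polar coordinates `(r, θ) ↦ circPt r θ`. -/
def circPtDeriv (p : ℝ × ℝ) : ℝ × ℝ →L[ℝ] E2 :=
  (ContinuousLinearMap.fst ℝ ℝ ℝ).smulRight (cos p.2 • EuclideanSpace.single 0 (1:ℝ)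
    + sin p.2 • EuclideanSpace.single 1 (1:ℝ)) +
  (ContinuousLinearMap.snd ℝ ℝ ℝ).smulRight ((-(p.1 * sin p.2)) • EuclideanSpace.single 0 (1:ℝ)
    + (p.1 * cos p.2) • EuclideanSpace.single 1 (1:ℝ))

lemma hasFDerivAt_circPt (p : ℝ × ℝ) :
    HasFDerivAt (fun q : ℝ × ℝ => circPt q.1 q.2) (circPtDeriv p) p := by
  simp only [circPt_eq]
  have hc := (hasFDerivAt_fst (𝕜 := ℝ) (p := p)).mul (hasFDerivAt_snd (𝕜 := ℝ) (p := p)).cos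
  have hs := (hasFDerivAt_fst (𝕜 := ℝ) (p := p)).mul (hasFDerivAt_snd (𝕜 := ℝ) (p := p)).sin
  refine ((hc.smul_const (EuclideanSpace.single 0 (1:ℝ) : E2)).add
    (hs.smul_const (EuclideanSpace.single 1 (1:ℝ) : E2))).congr_fderiv ?_
  refine ContinuousLinearMap.ext fun x => ?_
  ext i
  fin_cases i <;> simp [circPtDeriv] <;> ring

lemma continuous_circPt : Continuous fun p : ℝ × ℝ => circPt p.1 p.2 :=
  continuous_iff_continuousAt.2 fun p => (hasFDerivAt_circPt p).continuousAt

lemma circPtDeriv_apply_fst (p : ℝ × ℝ) : circPtDeriv p (1, 0) =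
    cos p.2 • EuclideanSpace.single 0 (1:ℝ) + sin p.2 • EuclideanSpace.single 1 (1:ℝ) := by
  simp [circPtDeriv]

lemma circPtDeriv_apply_snd (p : ℝ × ℝ) : circPtDeriv p (0, 1) =
    (-(p.1 * sin p.2)) • EuclideanSpace.single 0 (1:ℝ)
      + (p.1 * cos p.2) • EuclideanSpace.single 1 (1:ℝ) := by
  simp [circPtDeriv]

/-- Integration over a disk in polar coordinates. -/
lemma setIntegral_ball_eq_polar (R : ℝ) (h : E2 → ℂ) :
    ∫ x in Metric.ball (0:E2) R, h x =
      ∫ p in Set.Icc ((0:ℝ), -π) (R, π), p.1 • h (circPt p.1 p.2) := by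
  let e : E2 ≃ᵐ ℝ × ℝ :=
    (MeasurableEquiv.toLp 2 (Fin 2 → ℝ)).symm.trans MeasurableEquiv.finTwoArrow
  have he : MeasurePreserving e :=
    (volume_preserving_finTwoArrow ℝ).comp
      (EuclideanSpace.volume_preserving_symm_measurableEquiv_toLp (Fin 2))
  have hpolar (p : ℝ × ℝ) : e.symm (polarCoord.symm p) = circPt p.1 p.2 := by
    ext i
    fin_cases i <;> rfl
  rw [← integral_indicator Metric.isOpen_ball.measurableSet,
    ← he.symm.integral_comp' (f := e.symm),
    ← integral_comp_polarCoord_symm]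
  simp only [hpolar, polarCoord_target]
  have hind : Set.EqOn
      (fun p : ℝ × ℝ => p.1 • (Metric.ball (0:E2) R).indicator h (circPt p.1 p.2))
      ((Set.Iio R ×ˢ Set.univ).indicator fun p : ℝ × ℝ => p.1 • h (circPt p.1 p.2))
      (Set.Ioi 0 ×ˢ Set.Ioo (-π) π) := by
    rintro ⟨r, θ⟩ ⟨hr, -⟩
    have hr' : (0:ℝ) < r := hr
    by_cases hrR : r < R <;>
      simp [Set.indicator, norm_circPt, abs_of_pos hr', hrR]
  rw [setIntegral_congr_fun (measurableSet_Ioi.prod measurableSet_Ioo) hind,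
    setIntegral_indicator (measurableSet_Iio.prod MeasurableSet.univ), Set.prod_inter_prod,
    Set.inter_univ, Set.Ioi_inter_Iio, Set.Icc_prod_eq]
  exact setIntegral_congr_set (Measure.set_prod_ae_eq Ioo_ae_eq_Icc Ioo_ae_eq_Icc)

lemma fderiv_circPtDeriv_fst (f : E2 → ℂ) (x : E2) (p : ℝ × ℝ) :
    fderiv ℝ f x (circPtDeriv p (1, 0)) = cos p.2 • pd 0 f x + sin p.2 • pd 1 f x := by
  simp only [circPtDeriv_apply_fst, map_add, map_smul, pd]

lemma fderiv_circPtDeriv_snd (f : E2 → ℂ) (x : E2) (p : ℝ × ℝ) :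
    fderiv ℝ f x (circPtDeriv p (0, 1)) =
      (-(p.1 * sin p.2)) • pd 0 f x + (p.1 * cos p.2) • pd 1 f x := by
  simp only [circPtDeriv_apply_snd, map_add, map_smul, pd]

/-- The divergence theorem on a disk. -/
theorem integral_ball_divergence {R : ℝ} (hR : 0 ≤ R) {U : Set E2} (hU : IsOpen U)
    (hUR : Metric.closedBall (0:E2) R ⊆ U) {P Q : E2 → ℂ} (hP : ContDiffOn ℝ 1 P U)
    (hQ : ContDiffOn ℝ 1 Q U) :
    ∫ x in Metric.ball (0:E2) R, (pd 0 P x + pd 1 Q x) =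
      ∫ θ in (0:ℝ)..(2 * π),
        (cos θ • P (circPt R θ) + sin θ • Q (circPt R θ)) * (R:ℂ) := by
  have hmem {p : ℝ × ℝ} (hp : p ∈ Set.Icc ((0:ℝ), -π) (R, π)) : circPt p.1 p.2 ∈ U :=
    hUR (circPt_mem_closedBall ⟨hp.1.1, hp.2.1⟩ _)
  have hd {F : E2 → ℂ} (hF : ContDiffOn ℝ 1 F U) {p : ℝ × ℝ}
      (hp : p ∈ Set.Icc ((0:ℝ), -π) (R, π)) :
      HasFDerivAt (fun q : ℝ × ℝ => F (circPt q.1 q.2))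
        (fderiv ℝ F (circPt p.1 p.2) ∘L circPtDeriv p) p :=
    HasFDerivAt.comp p ((hF.differentiableOn one_ne_zero).differentiableAt
      (hU.mem_nhds (hmem hp))).hasFDerivAt (hasFDerivAt_circPt p)
  have hcos (p : ℝ × ℝ) := (hasFDerivAt_snd (𝕜 := ℝ) (p := p)).cos
  have hsin (p : ℝ × ℝ) := (hasFDerivAt_snd (𝕜 := ℝ) (p := p)).sin
  have hf {p : ℝ × ℝ} (hp : p ∈ Set.Icc ((0:ℝ), -π) (R, π)) :=
    (hasFDerivAt_fst (𝕜 := ℝ) (p := p)).smul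
      (((hcos p).smul (hd hP hp)).add ((hsin p).smul (hd hQ hp)))
  have hg {p : ℝ × ℝ} (hp : p ∈ Set.Icc ((0:ℝ), -π) (R, π)) :=
    ((hcos p).smul (hd hQ hp)).sub ((hsin p).smul (hd hP hp))
  set f : ℝ × ℝ → ℂ := fun p =>
    p.1 • (cos p.2 • P (circPt p.1 p.2) + sin p.2 • Q (circPt p.1 p.2)) with hf_def
  set g : ℝ × ℝ → ℂ := fun p =>
    cos p.2 • Q (circPt p.1 p.2) - sin p.2 • P (circPt p.1 p.2) with hg_def
  have hdiv : Set.EqOn (fun p : ℝ × ℝ => fderiv ℝ f p (1, 0) + fderiv ℝ g p (0, 1))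
      (fun p => p.1 • (pd 0 P (circPt p.1 p.2) + pd 1 Q (circPt p.1 p.2)))
      (Set.Icc ((0:ℝ), -π) (R, π)) := by
    intro p hp
    have h1 : fderiv ℝ f p = _ := (hf hp).fderiv
    have h2 : fderiv ℝ g p = _ := (hg hp).fderiv
    simp only [h1, h2]
    simp [fderiv_circPtDeriv_fst, fderiv_circPtDeriv_snd]
    linear_combination (p.1 : ℂ) *
      (pd 0 P (circPt p.1 p.2) + pd 1 Q (circPt p.1 p.2)) *
        Complex.cos_sq_add_sin_sq p.2
  have hcont : ContinuousOn
      (fun p : ℝ × ℝ => p.1 • (pd 0 P (circPt p.1 p.2) + pd 1 Q (circPt p.1 p.2)))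
      (Set.Icc ((0:ℝ), -π) (R, π)) :=
    continuousOn_fst.smul (((contDiffOn_pd hU hP (m := 0) (by simp) 0).continuousOn.add
      (contDiffOn_pd hU hQ (m := 0) (by simp) 1).continuousOn).comp
        continuous_circPt.continuousOn fun _ hp => hmem hp)
  have hsub : Set.Ioo (0:ℝ) R ×ˢ Set.Ioo (-π) π ⊆ Set.Icc ((0:ℝ), -π) (R, π) := by
    rw [Set.Icc_prod_eq]
    exact Set.prod_mono Set.Ioo_subset_Icc_self Set.Ioo_subset_Icc_self
  have key := integral_divergence_prod_Icc_of_hasFDerivAt_of_le f g (fderiv ℝ f) (fderiv ℝ g)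
    (0, -π) (R, π) ⟨hR, by linarith [pi_pos]⟩
    (fun p hp => (hf hp).continuousAt.continuousWithinAt)
    (fun p hp => (hg hp).continuousAt.continuousWithinAt)
    (fun p hp => (hf (hsub hp)).differentiableAt.hasFDerivAt)
    (fun p hp => (hg (hsub hp)).differentiableAt.hasFDerivAt)
    ((hcont.integrableOn_compact isCompact_Icc).congr_fun hdiv.symm measurableSet_Icc)
  rw [setIntegral_ball_eq_polar, ← setIntegral_congr_fun measurableSet_Icc hdiv, key]
  have hper : Function.Periodic (fun θ => f (R, θ)) (2 * π) := fun θ => by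
    simp only [hf_def, circPt, cos_add_two_pi, sin_add_two_pi]
  have hshift : ∫ θ in (-π)..π, f (R, θ) = ∫ θ in (0:ℝ)..(2 * π), f (R, θ) := by
    simpa [two_mul] using hper.intervalIntegral_add_eq (-π) 0
  have hg_ends (r : ℝ) : g (r, π) = g (r, -π) := by simp [hg_def, circPt]
  have hf_zero (θ : ℝ) : f (0, θ) = 0 := by simp [hf_def]
  simp only [hg_ends, hf_zero, sub_self, zero_add, intervalIntegral.integral_zero, sub_zero, hshift]
  simp only [hf_def, Complex.real_smul, mul_comm (R:ℂ)]

lemma dnu_circPt {R : ℝ} (hR : R ≠ 0) (f : E2 → ℂ) (θ : ℝ) :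
    dnu R f (circPt R θ) = cos θ • pd 0 f (circPt R θ) + sin θ • pd 1 f (circPt R θ) := by
  simp only [dnu, pd, ← map_smul, ← map_add]
  congr 1
  rw [circPt_eq, smul_add, smul_smul, smul_smul, inv_mul_cancel_left₀ hR, inv_mul_cancel_left₀ hR]

lemma pd_mul {i : Fin 2} {f g : E2 → ℂ} {x : E2} (hf : DifferentiableAt ℝ f x)
    (hg : DifferentiableAt ℝ g x) :
    pd i (fun y => f y * g y) x = f x * pd i g x + pd i f x * g x := by
  simp only [pd, fderiv_fun_mul hf hg]
  simp [mul_comm]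

/-- Green's second identity on a disk. -/
theorem integral_ball_lap_mul_sub {R : ℝ} (hR : 0 < R) {U : Set E2} (hU : IsOpen U)
    (hUR : Metric.closedBall (0:E2) R ⊆ U) {f g : E2 → ℂ} (hf : ContDiffOn ℝ 2 f U)
    (hg : ContDiffOn ℝ 2 g U) :
    ∫ x in Metric.ball (0:E2) R, (lap f x * g x - f x * lap g x) =
      circInt R (fun x => dnu R f x * g x - f x * dnu R g x) := by
  have hpf (i : Fin 2) : ContDiffOn ℝ 1 (pd i f) U := contDiffOn_pd hU hf one_add_one_eq_two.le i
  have hpg (i : Fin 2) : ContDiffOn ℝ 1 (pd i g) U := contDiffOn_pd hU hg one_add_one_eq_two.le i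
  have hf1 := hf.of_le one_le_two
  have hg1 := hg.of_le one_le_two
  have hflux (i : Fin 2) : ContDiffOn ℝ 1 (fun x => pd i f x * g x - f x * pd i g x) U :=
    ((hpf i).mul hg1).sub (hf1.mul (hpg i))
  have hdiv (i : Fin 2) {x : E2} (hx : x ∈ U) :
      pd i (fun x => pd i f x * g x - f x * pd i g x) x =
        pd i (pd i f) x * g x - f x * pd i (pd i g) x := by
    have hdiff {F : E2 → ℂ} (hF : ContDiffOn ℝ 1 F U) : DifferentiableAt ℝ F x :=
      (hF.differentiableOn one_ne_zero).differentiableAt (hU.mem_nhds hx)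
    have h1 := hdiff (hpf i)
    have h2 := hdiff (hpg i)
    have h3 := hdiff hf1
    have h4 := hdiff hg1
    have hsub : pd i (fun x => pd i f x * g x - f x * pd i g x) x =
        pd i (fun x => pd i f x * g x) x - pd i (fun x => f x * pd i g x) x :=
      DFunLike.congr_fun (fderiv_fun_sub (h1.mul h4) (h3.mul h2)) _
    rw [hsub, pd_mul h1 h4, pd_mul h3 h2]
    ring
  have key := integral_ball_divergence hR.le hU hUR (hflux 0) (hflux 1)
  rw [circInt]
  convert key using 1
  · refine setIntegral_congr_fun Metric.isOpen_ball.measurableSet fun x hx => ?_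
    have hxU := hUR (Metric.ball_subset_closedBall hx)
    simp only [hdiv _ hxU, lap_eq_sum_pd]
    ring
  · refine intervalIntegral.integral_congr fun θ _ => ?_
    simp only [dnu_circPt hR.ne', Complex.real_smul]
    ring

lemma integrableOn_ball_of_continuousOn {R : ℝ} {U : Set E2}
    (hUR : Metric.closedBall (0:E2) R ⊆ U) {h : E2 → ℂ} (hh : ContinuousOn h U) :
    IntegrableOn h (Metric.ball 0 R) :=
  ((hh.mono hUR).integrableOn_compact (isCompact_closedBall _ _)).mono_set
    Metric.ball_subset_closedBall

lemma circInt_add {R : ℝ} (hR : 0 ≤ R) {g h : E2 → ℂ}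
    (hg : ContinuousOn g (Metric.closedBall 0 R)) (hh : ContinuousOn h (Metric.closedBall 0 R)) :
    circInt R (fun x => g x + h x) = circInt R g + circInt R h := by
  have hcirc : Continuous (circPt R) := continuous_circPt.comp (Continuous.prodMk_right R)
  have hint {F : E2 → ℂ} (hF : ContinuousOn F (Metric.closedBall 0 R)) :
      IntervalIntegrable (fun θ => F (circPt R θ) * (R:ℂ)) volume 0 (2 * π) :=
    ((hF.comp_continuous hcirc (circPt_mem_closedBall ⟨hR, le_rfl⟩)).mul
      continuous_const).intervalIntegrable _ _
  simp only [circInt, add_mul]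
  exact intervalIntegral.integral_add (hint hg) (hint hh)

lemma continuousOn_dnu {U : Set E2} (hU : IsOpen U) {f : E2 → ℂ} (hf : ContDiffOn ℝ 1 f U)
    (R : ℝ) : ContinuousOn (dnu R f) U :=
  (hf.continuousOn_fderiv_of_isOpen hU le_rfl).clm_apply (continuousOn_id.const_smul R⁻¹)


/-- Fourth-order Green identity on the disk `B_R` for a solution `v` of `Δ²v = k⁴v`. -/
theorem green_identity_fourth_order (k R : ℝ) (hk : 0 < k) (hR : 0 < R)
    (U : Set E2) (hU : IsOpen U) (hUR : Metric.closedBall (0:E2) R ⊆ U)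
    (u v : E2 → ℂ) (hu : ContDiffOn ℝ 4 u U) (hv : ContDiffOn ℝ 4 v U)
    (hveq : ∀ x ∈ U, lap (lap v) x - (k:ℂ)^4 * v x = 0) :
    ∫ x in Metric.ball (0:E2) R, (lap (lap u) x - (k:ℂ)^4 * u x) * v x =
      circInt R (fun x => dnu R (lap u) x * v x - dnu R v x * lap u x
        + dnu R u x * lap v x - dnu R (lap v) x * u x) := by
  have hu2 : ContDiffOn ℝ 2 u U := hu.of_le (by norm_num)
  have hv2 : ContDiffOn ℝ 2 v U := hv.of_le (by norm_num)
  have hlu : ContDiffOn ℝ 2 (lap u) U := contDiffOn_lap hU hu (by norm_num)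
  have hlv : ContDiffOn ℝ 2 (lap v) U := contDiffOn_lap hU hv (by norm_num)
  have hllu : ContinuousOn (lap (lap u)) U :=
    (contDiffOn_lap (m := 0) hU hlu (by norm_num)).continuousOn
  have hllv : ContinuousOn (lap (lap v)) U :=
    (contDiffOn_lap (m := 0) hU hlv (by norm_num)).continuousOn
  have hdnu {f : E2 → ℂ} (hf : ContDiffOn ℝ 2 f U) : ContinuousOn (dnu R f) U :=
    continuousOn_dnu hU (hf.of_le one_le_two) R
  have hgreen_lu_v := integral_ball_lap_mul_sub hR hU hUR hlu hv2
  have hgreen_u_lv := integral_ball_lap_mul_sub hR hU hUR hu2 hlv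
  have hcirc := circInt_add hR.le
    ((((hdnu hlu).mul hv2.continuousOn).sub (hlu.continuousOn.mul (hdnu hv2))).mono hUR)
    ((((hdnu hu2).mul hlv.continuousOn).sub (hu2.continuousOn.mul (hdnu hlv))).mono hUR)
  have hball := integral_add
    (integrableOn_ball_of_continuousOn hUR
      ((hllu.mul hv2.continuousOn).sub (hlu.continuousOn.mul hlv.continuousOn)))
    (integrableOn_ball_of_continuousOn hUR
      ((hlu.continuousOn.mul hlv.continuousOn).sub (hu2.continuousOn.mul hllv)))
  calc
    _ = ∫ x in Metric.ball (0:E2) R, ((lap (lap u) x * v x - lap u x * lap v x) +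
          (lap u x * lap v x - u x * lap (lap v) x)) := by
      refine setIntegral_congr_fun Metric.isOpen_ball.measurableSet fun x hx => ?_
      have hx' := hveq x (hUR (Metric.ball_subset_closedBall hx))
      linear_combination u x * hx'
    _ = _ := hball.trans (congrArg₂ (· + ·) hgreen_lu_v hgreen_u_lv)
    _ = _ := hcirc.symm
    _ = _ := by
      congr 1
      ext x
      simp only [Pi.sub_apply, Pi.mul_apply]
      ring
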